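/- arXiv:2004.07966 — 2 statements merged into one kernel-verified Lean document; each statement's English description precedes it below -/
import Mathlib

section
/- Let q ∈ [2,∞). There exists a constant c > 0 depending only on q such that for every real inner product space E and all a, b ∈ E, ⟨‖a‖^{q−2}a − ‖b‖^{q−2}b, a − b⟩ ≥ c‖a − b‖^q, where we use the convention that ‖x‖^{q−2}x = 0 when x = 0. -/
open scoped RealInnerProductSpace

noncomputable section

universe u

/-- The power of a difference is controlled by the sum of the powers. -/
theorem norm_sub_rpow_le_two_rpow_mul {E : Type*} [SeminormedAddCommGroup E] {p : ℝ} (hp : 0 ≤ p)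
    (a b : E) : ‖a - b‖ ^ p ≤ 2 ^ p * (‖a‖ ^ p + ‖b‖ ^ p) := by
  have key : ∀ x y : E, ‖y‖ ≤ ‖x‖ → ‖x - y‖ ^ p ≤ 2 ^ p * (‖x‖ ^ p + ‖y‖ ^ p) := fun x y h =>
    calc ‖x - y‖ ^ p ≤ (2 * ‖x‖) ^ p :=
          Real.rpow_le_rpow (norm_nonneg _) (by linarith [norm_sub_le x y]) hp
      _ = 2 ^ p * ‖x‖ ^ p := Real.mul_rpow zero_le_two (norm_nonneg _)
      _ ≤ 2 ^ p * (‖x‖ ^ p + ‖y‖ ^ p) := by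
          gcongr
          exact le_add_of_nonneg_right (by positivity)
  rcases le_total ‖b‖ ‖a‖ with h | h
  · exact key a b h
  · rw [norm_sub_rev, add_comm]
    exact key b a h

theorem real_inner_smul_sub_smul_sub {E : Type*} [SeminormedAddCommGroup E]
    [InnerProductSpace ℝ E] (s t : ℝ) (a b : E) :
    ⟪s • a - t • b, a - b⟫ =
      (s + t) / 2 * ‖a - b‖ ^ 2 + (s - t) * (‖a‖ ^ 2 - ‖b‖ ^ 2) / 2 := by
  rw [norm_sub_sq_real]
  simp only [inner_sub_left, inner_sub_right, real_inner_smul_left, real_inner_self_eq_norm_sq,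
    real_inner_comm a b]
  ring

theorem rpow_sub_rpow_mul_sq_sub_sq_nonneg {x y p : ℝ} (hx : 0 ≤ x) (hy : 0 ≤ y) (hp : 0 ≤ p) :
    0 ≤ (x ^ p - y ^ p) * (x ^ 2 - y ^ 2) := by
  rcases le_total x y with h | h
  · exact mul_nonneg_of_nonpos_of_nonpos (sub_nonpos.2 (Real.rpow_le_rpow hx h hp))
      (sub_nonpos.2 (by gcongr))
  · exact mul_nonneg (sub_nonneg.2 (Real.rpow_le_rpow hy h hp)) (sub_nonneg.2 (by gcongr))

/-- **strong monotonicity of the `q`-nonlinearity.** For `q ∈ [2,∞)` there is a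
constant `c > 0` depending only on `q` such that for every real inner product space `E` and all
`a, b ∈ E`, `⟨‖a‖^{q-2}a - ‖b‖^{q-2}b, a - b⟩ ≥ c ‖a - b‖^q`. -/
theorem q_monotonicity_lower_bound
    (q : ℝ) (hq : 2 ≤ q) :
    ∃ c : ℝ, 0 < c ∧
      ∀ (E : Type u) [NormedAddCommGroup E] [InnerProductSpace ℝ E] (a b : E),
        c * ‖a - b‖ ^ q ≤ ⟪‖a‖ ^ (q - 2) • a - ‖b‖ ^ (q - 2) • b, a - b⟫ := by
  have hp : 0 ≤ q - 2 := by linarith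
  refine ⟨(2 * 2 ^ (q - 2))⁻¹, by positivity, fun E _ _ a b => ?_⟩
  have hsplit : ‖a - b‖ ^ q = ‖a - b‖ ^ (q - 2) * ‖a - b‖ ^ 2 := by
    rw [← Real.rpow_two, ← Real.rpow_add' (norm_nonneg _) (by linarith), sub_add_cancel]
  have hnonneg := rpow_sub_rpow_mul_sq_sub_sq_nonneg (norm_nonneg a) (norm_nonneg b) hp
  rw [real_inner_smul_sub_smul_sub, hsplit]
  calc (2 * 2 ^ (q - 2))⁻¹ * (‖a - b‖ ^ (q - 2) * ‖a - b‖ ^ 2)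
      ≤ (2 * 2 ^ (q - 2))⁻¹ *
          (2 ^ (q - 2) * (‖a‖ ^ (q - 2) + ‖b‖ ^ (q - 2)) * ‖a - b‖ ^ 2) := by
        gcongr
        exact norm_sub_rpow_le_two_rpow_mul hp a b
    _ = (‖a‖ ^ (q - 2) + ‖b‖ ^ (q - 2)) / 2 * ‖a - b‖ ^ 2 := by
        have : (2 : ℝ) ^ (q - 2) ≠ 0 := by positivity
        field_simp
    _ ≤ _ := by linarith
end
end

section
/- Let q ∈ [2,∞). There exists a constant C depending only on q such that for every real inner product space E and all a, b ∈ E, ‖‖a‖^{q−2}a − ‖b‖^{q−2}b‖ ≤ C(‖a‖ + ‖b‖)^{q−2}‖a − b‖, where we use the convention that ‖x‖^{q−2}x = 0 when x = 0. -/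
open scoped RealInnerProductSpace

noncomputable section

universe u

lemma rpow_sub_rpow_mul_le {p x y : ℝ} (hp : 0 ≤ p) (hy : 0 ≤ y) (hyx : y ≤ x) :
    (x ^ p - y ^ p) * y ≤ p * x ^ p * (x - y) := by
  rcases (hy.trans hyx).eq_or_lt with rfl | hx
  · simp [le_antisymm hyx hy]
  obtain ⟨t, ht, rfl⟩ : ∃ t : ℝ, 0 ≤ t ∧ y = t * x :=
    ⟨y / x, by positivity, by field_simp⟩
  have hB : 1 + (p + 1) * (t - 1) ≤ t ^ p * t := by
    have h := one_add_mul_self_le_rpow_one_add (s := t - 1) (p := p + 1)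
      (by linarith) (by linarith)
    rwa [add_sub_cancel, Real.rpow_add_one' ht (by linarith)] at h
  rw [Real.mul_rpow ht hx.le]
  have hxp : 0 ≤ x ^ p * x := by positivity
  nlinarith [mul_le_mul_of_nonneg_left hB hxp]

lemma norm_rpow_smul_sub_le_of_norm_le {E : Type*} [SeminormedAddCommGroup E] [NormedSpace ℝ E]
    {p : ℝ} (hp : 0 ≤ p) {a b : E} (hab : ‖b‖ ≤ ‖a‖) :
    ‖‖a‖ ^ p • a - ‖b‖ ^ p • b‖ ≤ (p + 1) * (‖a‖ + ‖b‖) ^ p * ‖a - b‖ := by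
  have hpow : ‖b‖ ^ p ≤ ‖a‖ ^ p := by gcongr
  calc
    ‖‖a‖ ^ p • a - ‖b‖ ^ p • b‖ = ‖‖a‖ ^ p • (a - b) + (‖a‖ ^ p - ‖b‖ ^ p) • b‖ := by
      congr 1
      module
    _ ≤ ‖a‖ ^ p * ‖a - b‖ + (‖a‖ ^ p - ‖b‖ ^ p) * ‖b‖ := by
      refine (norm_add_le _ _).trans_eq ?_
      rw [norm_smul, norm_smul, Real.norm_of_nonneg (by positivity),
        Real.norm_of_nonneg (sub_nonneg.2 hpow)]
    _ ≤ ‖a‖ ^ p * ‖a - b‖ + p * ‖a‖ ^ p * ‖a - b‖ := by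
      refine add_le_add le_rfl ?_
      refine (rpow_sub_rpow_mul_le hp (norm_nonneg b) hab).trans ?_
      gcongr
      exact norm_sub_norm_le a b
    _ = (p + 1) * ‖a‖ ^ p * ‖a - b‖ := by ring
    _ ≤ (p + 1) * (‖a‖ + ‖b‖) ^ p * ‖a - b‖ := by
      gcongr
      exact le_add_of_nonneg_right (norm_nonneg b)

/-- **local Lipschitz bound for the `q`-nonlinearity.** For `q ∈ [2,∞)` there is a
constant `C` depending only on `q` such that for every real inner product space `E` and all
`a, b ∈ E`, `‖‖a‖^{q-2}a - ‖b‖^{q-2}b‖ ≤ C (‖a‖ + ‖b‖)^{q-2} ‖a - b‖`. -/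
theorem q_monotonicity_upper_bound
    (q : ℝ) (hq : 2 ≤ q) :
    ∃ C : ℝ, ∀ (E : Type u) [NormedAddCommGroup E] [InnerProductSpace ℝ E] (a b : E),
      ‖‖a‖ ^ (q - 2) • a - ‖b‖ ^ (q - 2) • b‖ ≤ C * (‖a‖ + ‖b‖) ^ (q - 2) * ‖a - b‖ := by
  have hp : 0 ≤ q - 2 := sub_nonneg.2 hq
  refine ⟨q - 2 + 1, fun E _ _ a b => ?_⟩
  rcases le_total ‖b‖ ‖a‖ with h | h
  · exact norm_rpow_smul_sub_le_of_norm_le hp h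
  · rw [norm_sub_rev, norm_sub_rev a b, add_comm ‖a‖]
    exact norm_rpow_smul_sub_le_of_norm_le hp h
end
end
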